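/- Let n ≥ 1 be an integer and suppose < is a left-invariant linear order on G_n with 1 < b⁻¹·a. Then it is not the case that 1 < a, b < 1, c < 1, and d < 1 all hold (Case 8 is impossible). -/

import Mathlib

/-- The four generators of the Kanenobu group `G n`. -/
inductive Gen : Type
  | a | b | c | d
  deriving DecidableEq

open FreeGroup in
/-- The four relators of the presentation of `G n`. -/
def kanenobuRels (n : ℕ) : Set (FreeGroup Gen) :=
  { ((of Gen.a)⁻¹ * of Gen.b) ^ (10 * n) * (of Gen.d)⁻¹ * (of Gen.a) ^ 2,
    ((of Gen.b)⁻¹) ^ 2 * of Gen.c * ((of Gen.b)⁻¹ * of Gen.a) ^ (10 * n),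
    ((of Gen.d)⁻¹ * of Gen.c) ^ (10 * n + 3) * (of Gen.c)⁻¹ * of Gen.b * ((of Gen.c)⁻¹) ^ 2,
    (of Gen.d) ^ 2 * (of Gen.a)⁻¹ * of Gen.d * ((of Gen.c)⁻¹ * of Gen.d) ^ (10 * n + 3) }

/-- The group `G n`, fundamental group of the double branched cover of `K_{-10n,10n+3}`. -/
abbrev G (n : ℕ) : Type := PresentedGroup (kanenobuRels n)

/-- The image of the generator `a` in `G n`. -/
def ga (n : ℕ) : G n := PresentedGroup.of Gen.a
/-- The image of the generator `b` in `G n`. -/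
def gb (n : ℕ) : G n := PresentedGroup.of Gen.b
/-- The image of the generator `c` in `G n`. -/
def gc (n : ℕ) : G n := PresentedGroup.of Gen.c
/-- The image of the generator `d` in `G n`. -/
def gd (n : ℕ) : G n := PresentedGroup.of Gen.d

/-- `lt` is a left-invariant linear (strict total) order on the group `G`. -/
def IsLeftInvariantLinearOrder (G : Type*) [Group G] (lt : G → G → Prop) : Prop :=
  IsStrictTotalOrder G lt ∧ ∀ f g h : G, lt g h → lt (f * g) (f * h)

section aux
variable {K : Type*} [Group K] {P : K → Prop}

theorem aux_pow (hm : ∀ g h, P g → P h → P (g * h)) {u : K} (hu : P u) (k : ℕ) : P (u ^ (k+1)) := by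
  induction k with
  | zero => simpa using hu
  | succ k ih => rw [pow_succ]; exact hm _ _ ih hu

theorem aux_main (h1 : ¬ P 1) (hm : ∀ g h, P g → P h → P (g * h))
    (ht : ∀ g, P g ∨ g = 1 ∨ P g⁻¹) (a b c d x z t X Z : K) (N M : ℕ)
    (hx : x = b⁻¹ * a) (hz : z = c⁻¹ * d) (htt : t = c⁻¹ * b) (hX : X = x ^ (N+1)) (hZ : Z = z ^ (M+1))
    (r1 : X = d⁻¹ * a ^ 2) (r2 : X = c⁻¹ * b ^ 2)
    (r3 : Z = c⁻¹ * b * c⁻¹ * c⁻¹) (r4 : Z = d⁻¹ * a * d⁻¹ * d⁻¹)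
    (px : P x) (pa : P a) (pb : P b⁻¹) (pc : P c⁻¹) (pd : P d⁻¹) : False := by
  have anti : ∀ g, P g → P g⁻¹ → False := fun g h h' => h1 (by simpa using hm _ _ h h')
  have pX : P X := hX ▸ aux_pow hm px N
  have pt : P t := by
    have : t = X * b⁻¹ := by rw [r2, htt]; group
    rw [this]; exact hm _ _ pX pb
  have pZ : P Z := by rw [r4]; exact hm _ _ (hm _ _ (hm _ _ pd pa) pd) pd
  have root : ∀ u k, ¬ P u → (u ^ (k+1) = 1 ∨ P (u ^ (k+1))⁻¹) := by
    intro u k hu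
    rcases ht u with h | h | h
    · exact absurd h hu
    · left; rw [h, one_pow]
    · right; rw [← inv_pow]; exact aux_pow hm h k
  have pz : P z := by
    by_contra h
    rcases root z M h with h | h
    · rw [← hZ] at h; exact h1 (h ▸ pZ)
    · rw [← hZ] at h; exact anti _ pZ h
  have up1 : P (c⁻¹ * z * c) := by
    by_contra h
    have e : (c⁻¹ * z * c) ^ (M+1) = c⁻¹ * Z * c := by
      have := conj_pow (a := c⁻¹) (b := z) (i := M+1)
      rw [inv_inv] at this
      rw [this, hZ]
    have q : P (Z * c) := by
      have : Z * c = t * c⁻¹ := by rw [r3, htt]; group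
      rw [this]; exact hm _ _ pt pc
    rcases root _ M h with h | h
    · rw [e] at h
      have : Z * c = c := by
        calc Z * c = c * (c⁻¹ * Z * c) := by group
          _ = c := by rw [h, mul_one]
      rw [this] at q; exact anti _ q pc
    · rw [e] at h
      have := hm _ _ q h
      have e2 : Z * c * (c⁻¹ * Z * c)⁻¹ = c := by group
      rw [e2] at this; exact anti _ this pc
  have hXx : X * x = x * X := by rw [hX, ← pow_succ, ← pow_succ']
  have hax : a = b * x := by rw [hx]; group
  have hbX : b * X⁻¹ = t⁻¹ := by rw [r2, htt]; group
  have up2 : P (t⁻¹ * x * t) := by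
    by_contra h
    have e : (t⁻¹ * x * t) ^ (N+1+1) = a * t := by
      have := conj_pow (a := t⁻¹) (b := x) (i := N+1+1)
      rw [inv_inv] at this
      rw [this, pow_succ, ← hX, ← hbX, hax]; group
    rcases root _ (N+1) h with h | h
    · rw [e] at h; exact h1 (h ▸ hm _ _ pa pt)
    · rw [e] at h; exact anti _ (hm _ _ pa pt) h
  have hd : d = a * t⁻¹ * x := by
    have e1 : d = a ^ 2 * X⁻¹ := by rw [r1]; group
    have e2 : x * X⁻¹ = X⁻¹ * x := by
      rw [eq_inv_mul_iff_mul_eq, ← mul_assoc, hXx]; group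
    calc d = a * (a * X⁻¹) := by rw [e1, pow_two]; group
      _ = a * (b * (x * X⁻¹)) := by rw [← mul_assoc b, ← hax]
      _ = a * ((b * X⁻¹) * x) := by rw [e2]; group
      _ = _ := by rw [hbX]; group
  have hd2 : d * d = Z⁻¹ * (x⁻¹ * t) := by
    have e1 : d * Z * (d * d) = a := by rw [r4]; group
    have e2 : d * d = Z⁻¹ * (d⁻¹ * a) := by
      rw [← e1]; group
    rw [e2]; congr 1
    conv_lhs => rw [hd]
    group
  have hc2 : c * c = Z⁻¹ * t := by rw [r3, htt, ← pow_two]; group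
  have key : (c⁻¹ * z * c) * z * (t⁻¹ * x * t) = 1 := by
    have : (c⁻¹ * z * c) * z = (c * c)⁻¹ * (d * d) := by rw [hz]; group
    rw [this, hc2, hd2]; group
  exact h1 (key ▸ hm _ _ (hm _ _ up1 pz) up2)

end aux

/-- Case 8 (`a` positive, `b,c,d` negative) is impossible. -/
theorem case8_impossible (n : ℕ) (hn : 1 ≤ n) (lt : G n → G n → Prop)
    (hlt : IsLeftInvariantLinearOrder (G n) lt) (hba : lt 1 ((gb n)⁻¹ * ga n)) :
    ¬ (lt 1 (ga n) ∧ lt (gb n) 1 ∧ lt (gc n) 1 ∧ lt (gd n) 1) := by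
  rintro ⟨pa, pb, pc, pd⟩
  obtain ⟨hto, hinv⟩ := hlt
  have neg : ∀ g : G n, lt g 1 → lt 1 g⁻¹ := fun g h => by simpa using hinv g⁻¹ _ _ h
  have rel : ∀ r ∈ kanenobuRels n, (PresentedGroup.mk (kanenobuRels n) r) = 1 := fun r hr =>
    (PresentedGroup.one_of_mem hr)
  have e1 := rel _ (Or.inl rfl)
  have e2 := rel _ (Or.inr (Or.inl rfl))
  have e3 := rel _ (Or.inr (Or.inr (Or.inl rfl)))
  have e4 := rel _ (Or.inr (Or.inr (Or.inr rfl)))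
  simp only [map_mul, map_pow, map_inv] at e1 e2 e3 e4
  change ((ga n)⁻¹ * gb n) ^ (10 * n) * (gd n)⁻¹ * (ga n) ^ 2 = 1 at e1
  change ((gb n)⁻¹) ^ 2 * gc n * ((gb n)⁻¹ * ga n) ^ (10 * n) = 1 at e2
  change ((gd n)⁻¹ * gc n) ^ (10 * n + 3) * (gc n)⁻¹ * gb n * ((gc n)⁻¹) ^ 2 = 1 at e3
  change (gd n) ^ 2 * (ga n)⁻¹ * gd n * ((gc n)⁻¹ * gd n) ^ (10 * n + 3) = 1 at e4
  obtain ⟨N, hN⟩ : ∃ N, 10 * n = N + 1 := ⟨10 * n - 1, by omega⟩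
  have i1 : (ga n)⁻¹ * gb n = ((gb n)⁻¹ * ga n)⁻¹ := by group
  have i2 : (gd n)⁻¹ * gc n = ((gc n)⁻¹ * gd n)⁻¹ := by group
  rw [i1, inv_pow] at e1
  rw [i2, inv_pow] at e3
  refine aux_main (P := fun g => lt 1 g) (hto.irrefl 1) ?_ ?_ (ga n) (gb n) (gc n) (gd n) _ _ _
    (((gb n)⁻¹ * ga n) ^ (10 * n)) (((gc n)⁻¹ * gd n) ^ (10 * n + 3)) N (10 * n + 2)
    rfl rfl rfl (by rw [hN]) rfl ?_ ?_ ?_ ?_ hba pa (neg _ pb) (neg _ pc) (neg _ pd)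
  · intro g h hg hh
    exact hto.trans _ _ _ hg (by simpa using hinv g _ _ hh)
  · intro g
    by_cases h : lt 1 g
    · exact Or.inl h
    · by_cases h' : lt g 1
      · exact Or.inr (Or.inr (neg _ h'))
      · exact Or.inr (Or.inl (hto.trichotomous _ _ h' h))
  · rw [mul_assoc, inv_mul_eq_one] at e1; exact e1
  · rw [mul_eq_one_iff_inv_eq] at e2; rw [← e2]; group
  · rw [mul_assoc, mul_assoc, inv_mul_eq_one] at e3; rw [e3]; group
  · rw [mul_eq_one_iff_inv_eq] at e4; rw [← e4]; group
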